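/- (Proposition 2.) Let Φzd : ℕ → Matrix (Fin p) (Fin m) ℝ and Φψd : ℕ → Matrix (Fin q) (Fin m) ℝ be kernels, θ ≥ 0, α ≥ 0, t_a, t_zd ∈ ℕ. Consider the feasible set S of signals d with: |d(k)| ≤ α for all k ≤ t_a, d(k) = 0 for all k > t_a, and |(Φψd * d)(τ)| ≤ θ for all τ ≤ t_a. Then the supremum over d ∈ S of max_{0 ≤ n ≤ t_a + t_zd} |(Φzd * d)(n)| equals the supremum over d ∈ S of max_{t_a ≤ n ≤ t_a + t_zd} |(Φzd * d)(n)|; that is, the maximization of the impact over all rows {0, …, t_a + t_zd} is equivalent to the maximization over the rows {t_a, …, t_a + t_zd} only. -/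

import Mathlib

/-- Causal convolution of a kernel `Φ` with a signal `d`:
`(Φ * d)(n) = ∑_{k=0}^{n} Φ(n−k) · d(k)`. -/
noncomputable def conv {p m : ℕ} (Φ : ℕ → Matrix (Fin p) (Fin m) ℝ)
    (d : ℕ → Fin m → ℝ) (n : ℕ) : Fin p → ℝ :=
  ∑ k ∈ Finset.range (n + 1), (Φ (n - k)).mulVec (d k)

/-- A signal `d` is feasible (Scenario 2, stealthiness enforced up to `t_a`) if
`|d(k)| ≤ α` for all `k ≤ t_a`, `d(k) = 0` for `k > t_a`, and
`|(Φψd * d)(τ)| ≤ θ` for all `τ ≤ t_a`. -/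
def Feasible {q m : ℕ} (Φψd : ℕ → Matrix (Fin q) (Fin m) ℝ) (θ α : ℝ)
    (t_a : ℕ) (d : ℕ → Fin m → ℝ) : Prop :=
  (∀ k, k ≤ t_a → ‖d k‖ ≤ α) ∧ (∀ k, t_a < k → d k = 0) ∧
  (∀ τ, τ ≤ t_a → ‖conv Φψd d τ‖ ≤ θ)

/-- The signal `d` delayed by `s` steps and cut off after time `t`. -/
def delay {m : ℕ} (s t : ℕ) (d : ℕ → Fin m → ℝ) (k : ℕ) : Fin m → ℝ :=
  if s ≤ k ∧ k ≤ t then d (k - s) else 0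

lemma conv_delay_of_lt {p m s t n : ℕ} (Φ : ℕ → Matrix (Fin p) (Fin m) ℝ)
    (d : ℕ → Fin m → ℝ) (hn : n < s) : conv Φ (delay s t d) n = 0 := by
  refine Finset.sum_eq_zero fun k hk => ?_
  have hk' : ¬(s ≤ k ∧ k ≤ t) := by
    rw [Finset.mem_range] at hk
    omega
  simp [delay, hk']

lemma conv_delay_add {p m s t n : ℕ} (Φ : ℕ → Matrix (Fin p) (Fin m) ℝ)
    (d : ℕ → Fin m → ℝ) (hn : s + n ≤ t) : conv Φ (delay s t d) (s + n) = conv Φ d n := by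
  unfold conv
  rw [add_assoc, Finset.sum_range_add, Finset.sum_eq_zero, zero_add]
  · refine Finset.sum_congr rfl fun k hk => ?_
    have hk' : s + k ≤ t := by
      rw [Finset.mem_range] at hk
      omega
    simp [delay, hk', Nat.add_sub_add_left]
  · intro k hk
    have hk' : ¬(s ≤ k ∧ k ≤ t) := by
      rw [Finset.mem_range] at hk
      omega
    simp [delay, hk']

lemma Feasible.delay {q m t_a s : ℕ} {Φψd : ℕ → Matrix (Fin q) (Fin m) ℝ} {θ α : ℝ}
    {d : ℕ → Fin m → ℝ} (hd : Feasible Φψd θ α t_a d) (hθ : 0 ≤ θ) (hα : 0 ≤ α) :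
    Feasible Φψd θ α t_a (delay s t_a d) := by
  refine ⟨fun k hk => ?_, fun k hk => if_neg (by omega), fun τ hτ => ?_⟩
  · unfold _root_.delay
    split_ifs
    · exact hd.1 _ (by omega)
    · simpa using hα
  · rcases lt_or_ge τ s with h | h
    · simpa [conv_delay_of_lt Φψd d h] using hθ
    · obtain ⟨r, rfl⟩ := Nat.exists_eq_add_of_le h
      rw [conv_delay_add Φψd d hτ]
      exact hd.2.2 r (by omega)

/-- Proposition 2: over the feasible set, maximizing the worst-case impact over the
rows `{0,…,t_a + t_zd}` is equivalent to maximizing it over the rows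
`{t_a,…,t_a + t_zd}` only. -/
theorem worst_attack_last_rows {p q m : ℕ}
    (Φzd : ℕ → Matrix (Fin p) (Fin m) ℝ)
    (Φψd : ℕ → Matrix (Fin q) (Fin m) ℝ)
    (θ α : ℝ) (hθ : 0 ≤ θ) (hα : 0 ≤ α) (t_a t_zd : ℕ) :
    sSup {x : ℝ | ∃ d : ℕ → Fin m → ℝ, Feasible Φψd θ α t_a d ∧
        x = (Finset.range (t_a + t_zd + 1)).sup' (by simp)
              (fun n => ‖conv Φzd d n‖)} =
    sSup {x : ℝ | ∃ d : ℕ → Fin m → ℝ, Feasible Φψd θ α t_a d ∧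
        x = (Finset.Icc t_a (t_a + t_zd)).sup' (by simp)
              (fun n => ‖conv Φzd d n‖)} := by
  refine csSup_eq_csSup_of_forall_exists_le ?_ ?_
  · rintro _ ⟨d, hd, rfl⟩
    obtain ⟨n, hn, hmax⟩ := Finset.exists_mem_eq_sup' (s := Finset.range (t_a + t_zd + 1))
      (by simp) (fun n => ‖conv Φzd d n‖)
    rw [Finset.mem_range] at hn
    rw [hmax]
    rcases le_total t_a n with h | h
    · exact ⟨_, ⟨d, hd, rfl⟩, Finset.le_sup' (fun n => ‖conv Φzd d n‖)
        (Finset.mem_Icc.2 ⟨h, by omega⟩)⟩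
    · refine ⟨_, ⟨delay (t_a - n) t_a d, hd.delay hθ hα, rfl⟩, ?_⟩
      have hconv : conv Φzd (delay (t_a - n) t_a d) t_a = conv Φzd d n := by
        simpa [Nat.sub_add_cancel h] using
          conv_delay_add (s := t_a - n) (t := t_a) (n := n) Φzd d (by omega)
      rw [← hconv]
      exact Finset.le_sup' (fun i => ‖conv Φzd (delay (t_a - n) t_a d) i‖)
        (Finset.mem_Icc.2 ⟨le_rfl, Nat.le_add_right t_a t_zd⟩)
  · rintro _ ⟨d, hd, rfl⟩
    refine ⟨_, ⟨d, hd, rfl⟩, Finset.sup'_mono _ (fun n hn => ?_) _⟩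
    rw [Finset.mem_Icc] at hn
    rw [Finset.mem_range]
    omega
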